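/- Let X be a finite set and let λ : P(X) → ℝ satisfy λ_∅ = 1. Let λ_min = min_{G ⊆ X} λ_G and assume −1 < λ_min < 0. Let γ > 0 be such that λ_H ≥ λ_min + γ for every H ⊆ X with λ_H ≠ λ_min. Set ν = −λ_min/(1−λ_min). Let f : P(X) → {0,1} be a Boolean function satisfying Σ_{G⊆X} λ_G·f̂(G)² = 0, and let μ(f) = 2^(−|X|)·Σ_{S⊆X} f(S). Then: (i) μ(f) ≤ ν; (ii) if μ(f) = ν, then f̂(G) = 0 for every G with G ≠ ∅ and λ_G ≠ λ_min; (iii) w := Σ_{G : G ≠ ∅ and λ_G ≠ λ_min} f̂(G)² satisfies w ≤ ν·(ν − μ(f))/((1−ν)·γ). -/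

import Mathlib

open scoped Classical

/-- The Fourier coefficient of `f : P(X) → ℝ` at `R ⊆ X`:
`f̂(R) = 2^(−|X|) · Σ_{S ⊆ X} f(S) · (−1)^(|R ∩ S|)`. -/
noncomputable def walshCoeff {X : Type*} [Fintype X] [DecidableEq X]
    (f : Finset X → ℝ) (R : Finset X) : ℝ :=
  (∑ S : Finset X, f S * (-1 : ℝ) ^ (R ∩ S).card) / 2 ^ (Fintype.card X)

/-- The (uniform) mean of `f : P(X) → ℝ`. -/
noncomputable def meanVal {X : Type*} [Fintype X] [DecidableEq X]
    (f : Finset X → ℝ) : ℝ :=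
  (∑ S : Finset X, f S) / 2 ^ (Fintype.card X)

theorem neg_one_pow_card_inter_eq_prod {X : Type*} [DecidableEq X] (R S : Finset X) :
    (-1 : ℝ) ^ (R ∩ S).card = ∏ x ∈ R, if x ∈ S then (-1 : ℝ) else 1 := by
  rw [Finset.prod_ite_mem, Finset.prod_const]

theorem sum_neg_one_pow_card_inter_mul {X : Type*} [Fintype X] [DecidableEq X]
    (S T : Finset X) :
    ∑ R : Finset X, (-1 : ℝ) ^ (R ∩ S).card * (-1 : ℝ) ^ (R ∩ T).card =
      if S = T then 2 ^ Fintype.card X else 0 := by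
  simp only [neg_one_pow_card_inter_eq_prod, ← Finset.prod_mul_distrib]
  rw [← Finset.powerset_univ, ← Finset.prod_one_add]
  split_ifs with h
  · subst h
    rw [← Finset.card_univ, ← Finset.prod_const]
    refine Finset.prod_congr rfl fun x _ => ?_
    split_ifs <;> norm_num
  · obtain ⟨x, hx⟩ : ∃ x, ¬(x ∈ S ↔ x ∈ T) := by
      by_contra! hc
      exact h (Finset.ext hc)
    refine Finset.prod_eq_zero (Finset.mem_univ x) ?_
    by_cases h₁ : x ∈ S <;> by_cases h₂ : x ∈ T <;> simp_all

/-- Parseval's identity for the Walsh coefficients. -/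
theorem sum_walshCoeff_sq {X : Type*} [Fintype X] [DecidableEq X] (f : Finset X → ℝ) :
    ∑ R : Finset X, walshCoeff f R ^ 2 = meanVal fun S => f S ^ 2 := by
  have key : ∑ R : Finset X, (∑ S : Finset X, f S * (-1 : ℝ) ^ (R ∩ S).card) ^ 2 =
      2 ^ Fintype.card X * ∑ S : Finset X, f S ^ 2 := by
    calc
      _ = ∑ R : Finset X, ∑ S : Finset X, ∑ T : Finset X,
          f S * f T * ((-1 : ℝ) ^ (R ∩ S).card * (-1 : ℝ) ^ (R ∩ T).card) := by
        refine Finset.sum_congr rfl fun R _ => ?_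
        rw [sq, Finset.sum_mul_sum]
        exact Finset.sum_congr rfl fun S _ => Finset.sum_congr rfl fun T _ => by ring
      _ = ∑ S : Finset X, ∑ T : Finset X, f S * f T *
          ∑ R : Finset X, (-1 : ℝ) ^ (R ∩ S).card * (-1 : ℝ) ^ (R ∩ T).card := by
        rw [Finset.sum_comm]
        refine Finset.sum_congr rfl fun S _ => ?_
        rw [Finset.sum_comm]
        simp only [Finset.mul_sum]
      _ = _ := by
        simp only [sum_neg_one_pow_card_inter_mul, mul_ite, mul_zero, Finset.sum_ite_eq,
          Finset.mem_univ, if_true, Finset.mul_sum]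
        exact Finset.sum_congr rfl fun S _ => by ring
  simp only [walshCoeff, meanVal, div_pow]
  rw [← Finset.sum_div, key]
  field_simp

theorem walshCoeff_empty {X : Type*} [Fintype X] [DecidableEq X] (f : Finset X → ℝ) :
    walshCoeff f ∅ = meanVal f := by
  simp [walshCoeff, meanVal]

theorem hoffman_bound
    (X : Type*) [Fintype X] [DecidableEq X]
    (lam : Finset X → ℝ) (hemp : lam ∅ = 1)
    (lmin : ℝ) (hlb : ∀ G : Finset X, lmin ≤ lam G) (hattained : ∃ G : Finset X, lam G = lmin)
    (hneg1 : -1 < lmin) (hneg0 : lmin < 0)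
    (γ : ℝ) (hγ : 0 < γ)
    (hgap : ∀ H : Finset X, lam H ≠ lmin → lmin + γ ≤ lam H)
    (f : Finset X → ℝ) (hbool : ∀ S : Finset X, f S = 0 ∨ f S = 1)
    (horth : ∑ G : Finset X, lam G * (walshCoeff f G) ^ 2 = 0) :
    meanVal f ≤ -lmin / (1 - lmin) ∧
    (meanVal f = -lmin / (1 - lmin) →
      ∀ G : Finset X, G ≠ ∅ → lam G ≠ lmin → walshCoeff f G = 0) ∧
    (∑ G ∈ Finset.univ.filter (fun G : Finset X => G ≠ ∅ ∧ lam G ≠ lmin),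
        (walshCoeff f G) ^ 2)
      ≤ (-lmin / (1 - lmin)) * ((-lmin / (1 - lmin)) - meanVal f) /
          ((1 - (-lmin / (1 - lmin))) * γ) := by
  set m := meanVal f with hm
  set w := ∑ G ∈ Finset.univ.filter (fun G : Finset X => G ≠ ∅ ∧ lam G ≠ lmin),
    (walshCoeff f G) ^ 2 with hw
  have hw0 : 0 ≤ w := Finset.sum_nonneg fun _ _ => sq_nonneg _
  have hm0 : 0 ≤ m := by
    refine div_nonneg (Finset.sum_nonneg fun S _ => ?_) (by positivity)
    rcases hbool S with h | h <;> simp [h]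
  have hparseval : ∑ G : Finset X, walshCoeff f G ^ 2 = m := by
    rw [sum_walshCoeff_sq, hm]
    congr 1
    funext S
    rcases hbool S with h | h <;> simp [h]
  have hspectral : lmin * m + (1 - lmin) * m ^ 2 + γ * w ≤ 0 := by
    calc
      _ = ∑ G : Finset X, (lmin * walshCoeff f G ^ 2 +
          (if G = ∅ then (1 - lmin) * walshCoeff f G ^ 2 else 0) +
          if G ≠ ∅ ∧ lam G ≠ lmin then γ * walshCoeff f G ^ 2 else 0) := by
        rw [Finset.sum_add_distrib, Finset.sum_add_distrib, ← Finset.mul_sum, hparseval,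
          Finset.sum_ite_eq' Finset.univ ∅, if_pos (Finset.mem_univ _), walshCoeff_empty,
          hw, Finset.mul_sum, Finset.sum_filter]
      _ ≤ ∑ G : Finset X, lam G * walshCoeff f G ^ 2 := by
        refine Finset.sum_le_sum fun G _ => ?_
        have hsq := sq_nonneg (walshCoeff f G)
        by_cases hG : G = ∅
        · subst hG
          simp [hemp]
          linarith
        · by_cases hl : lam G = lmin
          · simp [hG, hl]
          · simp only [hG, hl, if_false, ne_eq, not_false_eq_true, and_self, if_true]
            nlinarith [hgap G hl]
      _ = 0 := horth
  have hpos : 0 < 1 - lmin := by linarith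
  set ν := -lmin / (1 - lmin) with hν
  have hνl : ν * (1 - lmin) = -lmin := div_mul_cancel₀ _ hpos.ne'
  have hν1 : (1 - ν) * (1 - lmin) = 1 := by linarith
  have hν_pos : 0 < 1 - ν := pos_of_mul_pos_left (by rw [hν1]; exact one_pos) hpos.le
  have hγw : γ * w ≤ m * (ν - m) * (1 - lmin) := by nlinarith
  have hmν : m ≤ ν := by
    by_contra! hlt
    have hν0 : 0 < ν := div_pos (by linarith) hpos
    have : 0 < m * (m - ν) * (1 - lmin) :=
      mul_pos (mul_pos (by linarith) (by linarith)) hpos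
    nlinarith [mul_nonneg hγ.le hw0]
  have hbound : w ≤ ν * (ν - m) / ((1 - ν) * γ) := by
    rw [le_div_iff₀ (mul_pos hν_pos hγ)]
    calc
      w * ((1 - ν) * γ) = (1 - ν) * (γ * w) := by ring
      _ ≤ (1 - ν) * (m * (ν - m) * (1 - lmin)) := mul_le_mul_of_nonneg_left hγw hν_pos.le
      _ = m * (ν - m) * ((1 - ν) * (1 - lmin)) := by ring
      _ = m * (ν - m) := by rw [hν1, mul_one]
      _ ≤ ν * (ν - m) := mul_le_mul_of_nonneg_right hmν (by linarith)
  refine ⟨hmν, fun heq G hG hl => ?_, hbound⟩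
  have hwz : w = 0 := le_antisymm (by simpa [heq] using hbound) hw0
  have hGz := (Finset.sum_eq_zero_iff_of_nonneg fun _ _ => sq_nonneg _).1 hwz G (by simp [hG, hl])
  exact pow_eq_zero_iff two_ne_zero |>.1 hGz
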